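/- For every n ≥ 1, setting b̃_n = c̃^n_{x₀,x_{2^n}}, the conductances of the bottom row Ẽ_n computed at level n satisfy: c̃^n_{x₀,x_j} = 2b̃_n for 2^{n−1} < j < 2^n; c̃^n_{x_j,x_{2^n}} = 2b̃_n for 0 < j < 2^{n−1}; c̃^n_{x_i,x_j} = 4b̃_n for 0 < i < 2^{n−1} and 2^{n−1} < j < 2^n; and b̃_n = 35·5^n / (10·6^n + 32·20^n). -/

import Mathlib

open scoped BigOperators

noncomputable section

namespace SGPaper

/-- The three corners of the Sierpinski gasket:
`q₀ = (1/2, √3/2)`, `q₁ = (0,0)`, `q₂ = (1,0)`. -/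
def q : Fin 3 → ℝ × ℝ
  | 0 => (1 / 2, Real.sqrt 3 / 2)
  | 1 => (0, 0)
  | 2 => (1, 0)

/-- The contraction map towards corner `i`: `F_i(x) = (x + q_i)/2`. -/
def Fmap (i : Fin 3) (x : ℝ × ℝ) : ℝ × ℝ := (2⁻¹ : ℝ) • (x + q i)

/-- `Fword w = F_{w₁} ∘ ⋯ ∘ F_{w_m}` for the word `w = w₁⋯w_m`. -/
def Fword (w : List (Fin 3)) : ℝ × ℝ → ℝ × ℝ :=
  w.foldr (fun i f => Fmap i ∘ f) id

/-- The level-`m` vertex set of the Sierpinski gasket: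
`V_m = ⋃_{|w| = m} F_w({q₀, q₁, q₂})`. -/
def V (m : ℕ) : Set (ℝ × ℝ) :=
  {x | ∃ w : List (Fin 3), w.length = m ∧ ∃ i : Fin 3, x = Fword w (q i)}

/-- `x` and `y` are `m`-neighbors: they are distinct and belong to a common
level-`m` cell `F_w({q₀, q₁, q₂})`. -/
def Nbr (m : ℕ) (x y : ℝ × ℝ) : Prop :=
  x ≠ y ∧ ∃ w : List (Fin 3), w.length = m ∧
    (∃ i : Fin 3, x = Fword w (q i)) ∧ (∃ j : Fin 3, y = Fword w (q j))

/-- The value `(u x - u y)²` on the unordered pair `{x, y}`. -/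
def edgeVal (u : ℝ × ℝ → ℝ) : Sym2 (ℝ × ℝ) → ℝ :=
  Sym2.lift ⟨fun x y => (u x - u y) ^ 2, fun _ _ => by ring⟩

/-- The unordered pair `e` is an edge of the level-`m` graph `Γ_m`. -/
def IsEdge (m : ℕ) (e : Sym2 (ℝ × ℝ)) : Prop :=
  ∃ x y : ℝ × ℝ, Nbr m x y ∧ e = s(x, y)

/-- The level-`m` graph energy: `E_m(u) = (5/3)^m Σ (u x − u y)²`, the sum being over
unordered `m`-neighbor pairs `{x, y}` (a finite set, so `tsum` is the honest sum). -/
def Energy (m : ℕ) (u : ℝ × ℝ → ℝ) : ℝ :=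
  (5 / 3 : ℝ) ^ m * ∑' e : {e : Sym2 (ℝ × ℝ) // IsEdge m e}, edgeVal u e

/-- `Q_E(v)`: minimal level-`m` energy among functions `u : V_m → ℝ` agreeing
with `v` on `E` (the minimum is attained, so it equals this infimum). -/
def Q (m : ℕ) (E : Set (ℝ × ℝ)) (v : ℝ × ℝ → ℝ) : ℝ :=
  sInf {r | ∃ u : ℝ × ℝ → ℝ, (∀ x ∈ E, u x = v x) ∧ r = Energy m u}

/-- Indicator function of the point `z`. -/
def ind (z : ℝ × ℝ) : ℝ × ℝ → ℝ := fun t => if t = z then 1 else 0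

/-- The conductance `c^E_{x,y} = (Q_E(𝟙_x) + Q_E(𝟙_y) − Q_E(𝟙_x + 𝟙_y))/2`
between `x, y ∈ E`, computed at level `m`. -/
def cond (m : ℕ) (E : Set (ℝ × ℝ)) (x y : ℝ × ℝ) : ℝ :=
  (Q m E (ind x) + Q m E (ind y) - Q m E (ind x + ind y)) / 2

/-- The `j`-th bottom-row point of `V_n`: `x_j = q₁ + (j/2ⁿ)(q₂ − q₁)`. -/
def xb (n j : ℕ) : ℝ × ℝ := q 1 + ((j : ℝ) / 2 ^ n) • (q 2 - q 1)

/-- The bottom row `Ẽ_n = {x₀, …, x_{2ⁿ}}` of `V_n`. -/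
def Ebot (n : ℕ) : Set (ℝ × ℝ) := {p | ∃ j ≤ 2 ^ n, p = xb n j}

/-- The bottom row together with the top point: `E_n⁺ = {q₀, x₀, …, x_{2ⁿ}}`. -/
def Eplus (n : ℕ) : Set (ℝ × ℝ) := insert (q 0) (Ebot n)

/-- the set of level-`m` edges -/
def edges (m : ℕ) : Set (Sym2 (ℝ × ℝ)) := {e | IsEdge m e}

/-- barycentric coordinates -/
def bc (i : Fin 3) (p : ℝ × ℝ) : ℝ :=
  match i with
  | 0 => 2 * p.2 / Real.sqrt 3
  | 1 => 1 - p.1 - p.2 / Real.sqrt 3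
  | 2 => p.1 - p.2 / Real.sqrt 3

/-- the closed triangle -/
def T : Set (ℝ × ℝ) := {p | ∀ i, 0 ≤ bc i p}

lemma s3 : Real.sqrt 3 ≠ 0 := by positivity

lemma bc_sum (p : ℝ × ℝ) : bc 0 p + bc 1 p + bc 2 p = 1 := by
  simp only [bc]; ring

lemma bc_q (i j : Fin 3) : bc i (q j) = if i = j then 1 else 0 := by
  have := s3
  fin_cases i <;> fin_cases j <;> simp [bc, q] <;> field_simp <;> norm_num

lemma bc_F (i j : Fin 3) (p : ℝ × ℝ) :
    bc i (Fmap j p) = (bc i p + if i = j then 1 else 0) / 2 := by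
  have := s3
  fin_cases i <;> fin_cases j <;> simp [bc, q, Fmap] <;> field_simp <;> ring

lemma bc_inj {p p' : ℝ × ℝ} (h : ∀ i, bc i p = bc i p') : p = p' := by
  have := s3
  have h0 := h 0
  have h2 := h 2
  simp only [bc] at h0 h2
  field_simp at h0
  have h1 : p.2 = p'.2 := by linarith
  rw [h1] at h2
  exact Prod.ext (by linarith) h1

lemma F_inj (i : Fin 3) : Function.Injective (Fmap i) := by
  intro p p' h
  apply bc_inj
  intro k
  have := congrArg (bc k) h
  rw [bc_F, bc_F] at this
  linarith

lemma q_inj : Function.Injective q := by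
  intro i j h
  by_contra hij
  have := congrArg (bc i) h
  rw [bc_q, bc_q] at this
  simp [hij] at this

lemma q_mem_T (i : Fin 3) : q i ∈ T := by
  intro k
  rw [bc_q]; split_ifs <;> norm_num

lemma F_mem_T {p : ℝ × ℝ} (hp : p ∈ T) (i : Fin 3) : Fmap i p ∈ T := by
  intro k
  rw [bc_F]
  have := hp k
  split_ifs <;> linarith

lemma Fword_mem_T (w : List (Fin 3)) {p : ℝ × ℝ} (hp : p ∈ T) : Fword w p ∈ T := by
  induction w with
  | nil => exact hp
  | cons i w ih => exact F_mem_T ih i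

lemma F_swap (i j : Fin 3) : Fmap i (q j) = Fmap j (q i) := by
  simp only [Fmap, add_comm]

lemma F_fix (i : Fin 3) : Fmap i (q i) = q i := by
  apply bc_inj
  intro k
  rw [bc_F, bc_q]; split_ifs <;> norm_num

lemma F_overlap {i j : Fin 3} (hij : i ≠ j) {p p' : ℝ × ℝ} (hp : p ∈ T) (hp' : p' ∈ T)
    (h : Fmap i p = Fmap j p') : p = q j ∧ p' = q i := by
  have e : ∀ k, (bc k p + if k = i then 1 else 0) = (bc k p' + if k = j then 1 else 0) := by
    intro k
    have := congrArg (bc k) h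
    rw [bc_F, bc_F] at this
    linarith
  have s := bc_sum p
  have s' := bc_sum p'
  constructor <;> apply bc_inj <;> intro k <;> rw [bc_q] <;>
  · have e0 := e 0
    have e1 := e 1
    have e2 := e 2
    have a0 := hp 0
    have a1 := hp 1
    have a2 := hp 2
    have b0 := hp' 0
    have b1 := hp' 1
    have b2 := hp' 2
    fin_cases i <;> fin_cases j <;> fin_cases k <;> simp at hij e0 e1 e2 ⊢ <;> linarith

lemma edges_succ (m : ℕ) : edges (m + 1) = ⋃ i, Sym2.map (Fmap i) '' edges m := by
  ext e
  simp only [Set.mem_iUnion, Set.mem_image]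
  constructor
  · rintro ⟨x, y, ⟨hxy, w, hw, ⟨i, rfl⟩, ⟨j, rfl⟩⟩, rfl⟩
    cases w with
    | nil => simp at hw
    | cons k w =>
      refine ⟨k, s(Fword w (q i), Fword w (q j)), ⟨_, _, ⟨?_, w, by simpa using hw, ⟨i, rfl⟩, ⟨j, rfl⟩⟩, rfl⟩, ?_⟩
      · intro h
        exact hxy (congrArg (Fmap k) h)
      · rfl
  · rintro ⟨k, _, ⟨x, y, ⟨hxy, w, hw, ⟨i, rfl⟩, ⟨j, rfl⟩⟩, rfl⟩, rfl⟩
    exact ⟨_, _, ⟨fun h => hxy (F_inj k h), k :: w, by simp [hw], ⟨i, rfl⟩, ⟨j, rfl⟩⟩, rfl⟩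

lemma edges_zero : edges 0 = {s(q 0, q 1), s(q 1, q 2), s(q 0, q 2)} := by
  ext e
  simp only [Set.mem_insert_iff, Set.mem_singleton_iff]
  constructor
  · rintro ⟨x, y, ⟨hxy, w, hw, ⟨i, rfl⟩, ⟨j, rfl⟩⟩, rfl⟩
    rw [List.length_eq_zero_iff] at hw
    subst hw
    simp only [Fword, List.foldr_nil, id] at hxy ⊢
    fin_cases i <;> fin_cases j <;> simp at hxy ⊢
  · have key : ∀ i j : Fin 3, i ≠ j → s(q i, q j) ∈ edges 0 := fun i j hij =>
      ⟨_, _, ⟨fun h => hij (q_inj h), [], rfl, ⟨i, rfl⟩, ⟨j, rfl⟩⟩, rfl⟩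
    rintro (rfl | rfl | rfl) <;> apply key <;> decide

lemma edges_finite (m : ℕ) : (edges m).Finite := by
  induction m with
  | zero => rw [edges_zero]; simp
  | succ m ih =>
    rw [edges_succ]
    exact Set.finite_iUnion fun i => ih.image _

lemma Energy_eq (m : ℕ) (u : ℝ × ℝ → ℝ) :
    Energy m u = (5 / 3 : ℝ) ^ m * ∑ᶠ e ∈ edges m, edgeVal u e := by
  have : Finite (edges m) := edges_finite m
  rw [Energy, ← finsum_set_coe_eq_finsum_mem]
  congr 1
  have h : ∑' e : edges m, edgeVal u e = ∑ᶠ e : edges m, edgeVal u e :=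
    tsum_eq_finsum (L := SummationFilter.unconditional (edges m)) (Set.toFinite _)
  exact h

lemma edgeVal_map (u : ℝ × ℝ → ℝ) (f : ℝ × ℝ → ℝ × ℝ) (e : Sym2 (ℝ × ℝ)) :
    edgeVal u (Sym2.map f e) = edgeVal (u ∘ f) e := by
  induction e with
  | _ x y => rfl

/-- triangle energy -/
def E0 (a b c : ℝ) : ℝ := (a - b) ^ 2 + (b - c) ^ 2 + (a - c) ^ 2

lemma Energy_zero (u : ℝ × ℝ → ℝ) : Energy 0 u = E0 (u (q 0)) (u (q 1)) (u (q 2)) := by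
  have h01 : q 0 ≠ q 1 := fun h => absurd (q_inj h) (by decide)
  have h02 : q 0 ≠ q 2 := fun h => absurd (q_inj h) (by decide)
  have h12 : q 1 ≠ q 2 := fun h => absurd (q_inj h) (by decide)
  rw [Energy_eq, edges_zero, finsum_mem_insert, finsum_mem_insert, finsum_mem_singleton]
  · simp [edgeVal, E0, add_assoc]
  · simp [h01, h01.symm, h12, h12.symm, h02, h02.symm]
  · simp
  · simp [h01, h01.symm, h12, h12.symm, h02, h02.symm]
  · simp

lemma Energy_succ (m : ℕ) (u : ℝ × ℝ → ℝ) :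
    Energy (m + 1) u = 5 / 3 * (Energy m (u ∘ Fmap 0) + Energy m (u ∘ Fmap 1)
      + Energy m (u ∘ Fmap 2)) := by
  have key : ∑ᶠ e ∈ edges (m + 1), edgeVal u e
      = ∑ i : Fin 3, ∑ᶠ e ∈ edges m, edgeVal (u ∘ Fmap i) e := by
    rw [edges_succ, finsum_mem_iUnion, finsum_eq_sum_of_fintype]
    · refine Finset.sum_congr rfl fun i _ => ?_
      rw [finsum_mem_image (Sym2.map.injective (F_inj i)).injOn]
      simp only [edgeVal_map]
    · intro i j hij
      rw [Function.onFun, Set.disjoint_left]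
      rintro _ ⟨_, ⟨x, y, ⟨hxy, w, hw, ⟨a, rfl⟩, ⟨b, rfl⟩⟩, rfl⟩, rfl⟩
        ⟨_, ⟨x', y', ⟨hxy', w', hw', ⟨a', rfl⟩, ⟨b', rfl⟩⟩, rfl⟩, h⟩
      have t := fun w a => Fword_mem_T w (q_mem_T a)
      simp only [Sym2.map_mk, Sym2.eq_iff] at h
      rcases h with ⟨h1, h2⟩ | ⟨h1, h2⟩
      · exact hxy ((F_overlap hij (t _ _) (t _ _) h1.symm).1.trans
          (F_overlap hij (t _ _) (t _ _) h2.symm).1.symm)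
      · exact hxy ((F_overlap hij (t _ _) (t _ _) h2.symm).1.trans
          (F_overlap hij (t _ _) (t _ _) h1.symm).1.symm)
    · exact fun i => (edges_finite m).image _
  simp only [Energy_eq, key, Fin.sum_univ_three]
  ring

lemma Energy_congr (m : ℕ) {u v : ℝ × ℝ → ℝ} (h : ∀ p ∈ T, u p = v p) :
    Energy m u = Energy m v := by
  induction m generalizing u v with
  | zero => simp only [Energy_zero, h _ (q_mem_T _)]
  | succ m ih =>
    simp only [Energy_succ]
    rw [ih (u := u ∘ Fmap 0) (v := v ∘ Fmap 0) fun p hp => h _ (F_mem_T hp 0),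
      ih (u := u ∘ Fmap 1) (v := v ∘ Fmap 1) fun p hp => h _ (F_mem_T hp 1),
      ih (u := u ∘ Fmap 2) (v := v ∘ Fmap 2) fun p hp => h _ (F_mem_T hp 2)]

lemma glue (f : Fin 3 → ℝ × ℝ → ℝ) (h : ∀ i j, f i (q j) = f j (q i)) :
    ∃ u : ℝ × ℝ → ℝ, ∀ i, ∀ p ∈ T, u (Fmap i p) = f i p := by
  classical
  refine ⟨fun x => if hx : ∃ i, ∃ p ∈ T, Fmap i p = x then
    f hx.choose hx.choose_spec.choose else 0, ?_⟩
  intro i p hp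
  have hx : ∃ j, ∃ p' ∈ T, Fmap j p' = Fmap i p := ⟨i, p, hp, rfl⟩
  simp only [dif_pos hx]
  obtain ⟨hp', he⟩ := hx.choose_spec.choose_spec
  generalize hx.choose_spec.choose = p' at *
  generalize hx.choose = j at *
  by_cases hij : j = i
  · subst hij
    rw [F_inj _ he]
  · obtain ⟨rfl, rfl⟩ := F_overlap hij hp' hp he
    exact h _ _

lemma E0_lower (a b c x y z : ℝ) :
    E0 a b c ≤ 5 / 3 * (E0 a x y + E0 x b z + E0 y z c) := by
  have : 5 / 3 * (E0 a x y + E0 x b z + E0 y z c) = E0 a b c + 5 / 3 * (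
    let d := x - (2 * a + 2 * b + c) / 5
    let e := y - (2 * a + b + 2 * c) / 5
    let f := z - (a + 2 * b + 2 * c) / 5
    (d - e) ^ 2 + (e - f) ^ 2 + (d - f) ^ 2 + 2 * (d ^ 2 + e ^ 2 + f ^ 2)) := by
    simp only [E0]; ring
  rw [this]
  simp only
  linarith [show (0:ℝ) ≤ (5 / 3 * (
    let d := x - (2 * a + 2 * b + c) / 5
    let e := y - (2 * a + b + 2 * c) / 5
    let f := z - (a + 2 * b + 2 * c) / 5
    (d - e) ^ 2 + (e - f) ^ 2 + (d - f) ^ 2 + 2 * (d ^ 2 + e ^ 2 + f ^ 2))) by positivity]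

lemma corner_lower (m : ℕ) (u : ℝ × ℝ → ℝ) :
    E0 (u (q 0)) (u (q 1)) (u (q 2)) ≤ Energy m u := by
  induction m generalizing u with
  | zero => rw [Energy_zero]
  | succ m ih =>
    rw [Energy_succ]
    have h0 := ih (u ∘ Fmap 0)
    have h1 := ih (u ∘ Fmap 1)
    have h2 := ih (u ∘ Fmap 2)
    simp only [Function.comp, F_fix, F_swap 1 0, F_swap 2 0, F_swap 2 1] at h0 h1 h2
    have := E0_lower (u (q 0)) (u (q 1)) (u (q 2)) (u (Fmap 0 (q 1))) (u (Fmap 0 (q 2)))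
      (u (Fmap 1 (q 2)))
    linarith

/-- gluing three cell functions, with the energy of the result -/
lemma glue_energy (m : ℕ) (f₀ f₁ f₂ : ℝ × ℝ → ℝ) (h01 : f₀ (q 1) = f₁ (q 0))
    (h02 : f₀ (q 2) = f₂ (q 0)) (h12 : f₁ (q 2) = f₂ (q 1)) :
    ∃ u : ℝ × ℝ → ℝ, (∀ p ∈ T, u (Fmap 0 p) = f₀ p) ∧ (∀ p ∈ T, u (Fmap 1 p) = f₁ p) ∧
      (∀ p ∈ T, u (Fmap 2 p) = f₂ p) ∧
      Energy (m + 1) u = 5 / 3 * (Energy m f₀ + Energy m f₁ + Energy m f₂) := by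
  obtain ⟨u, hu⟩ := glue ![f₀, f₁, f₂] (by
    intro i j
    fin_cases i <;> fin_cases j <;> simp [h01, h02, h12])
  have a0 : ∀ p ∈ T, u (Fmap 0 p) = f₀ p := hu 0
  have a1 : ∀ p ∈ T, u (Fmap 1 p) = f₁ p := hu 1
  have a2 : ∀ p ∈ T, u (Fmap 2 p) = f₂ p := hu 2
  refine ⟨u, a0, a1, a2, ?_⟩
  rw [Energy_succ, Energy_congr m (u := u ∘ Fmap 0) a0, Energy_congr m (u := u ∘ Fmap 1) a1,
    Energy_congr m (u := u ∘ Fmap 2) a2]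

lemma corner_exists (m : ℕ) (a b c : ℝ) :
    ∃ u : ℝ × ℝ → ℝ, u (q 0) = a ∧ u (q 1) = b ∧ u (q 2) = c ∧ Energy m u = E0 a b c := by
  induction m generalizing a b c with
  | zero =>
    have h01 : q 1 ≠ q 0 := fun h => absurd (q_inj h) (by decide)
    have h02 : q 2 ≠ q 0 := fun h => absurd (q_inj h) (by decide)
    have h12 : q 2 ≠ q 1 := fun h => absurd (q_inj h) (by decide)
    classical
    refine ⟨fun p => if p = q 0 then a else if p = q 1 then b else c, ?_, ?_, ?_, ?_⟩
    · simp
    · simp [h01]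
    · simp [h02, h12]
    · simp [Energy_zero, h01, h02, h12]
  | succ m ih =>
    obtain ⟨f, hf0, hf1, hf2, hf⟩ := ih a ((2 * a + 2 * b + c) / 5) ((2 * a + b + 2 * c) / 5)
    obtain ⟨g, hg0, hg1, hg2, hg⟩ := ih ((2 * a + 2 * b + c) / 5) b ((a + 2 * b + 2 * c) / 5)
    obtain ⟨k, hk0, hk1, hk2, hk⟩ := ih ((2 * a + b + 2 * c) / 5) ((a + 2 * b + 2 * c) / 5) c
    obtain ⟨u, u0, u1, u2, hu⟩ := glue_energy m f g k (by rw [hf1, hg0]) (by rw [hf2, hk0])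
      (by rw [hg2, hk1])
    refine ⟨u, ?_, ?_, ?_, ?_⟩
    · rw [← F_fix, u0 _ (q_mem_T _), hf0]
    · rw [← F_fix, u1 _ (q_mem_T _), hg1]
    · rw [← F_fix, u2 _ (q_mem_T _), hk2]
    · rw [hu, hf, hg, hk]; simp only [E0]; ring

/-- conductance from the top to the bottom row -/
def al : ℕ → ℝ
  | 0 => 2
  | m + 1 => 10 * al m / (3 * (1 + al m))

lemma al_pos (m : ℕ) : 0 < al m := by
  induction m with
  | zero => norm_num [al]
  | succ m ih => rw [al]; positivity

lemma al_inv (m : ℕ) : (al m)⁻¹ = 3 / 7 + 1 / 14 * (3 / 10) ^ m := by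
  induction m with
  | zero => norm_num [al]
  | succ m ih =>
    have := al_pos m
    have h : (al (m + 1))⁻¹ = 3 / 10 * (1 + (al m)⁻¹) := by
      rw [al]; field_simp; ring
    rw [h, ih]; ring

/-- harmonic measure of the bottom row seen from the top -/
def mu (m : ℕ) (v : ℝ × ℝ → ℝ) : ℝ :=
  (∑ k ∈ Finset.range (2 ^ m), (v (xb m k) + v (xb m (k + 1)))) / 2 ^ (m + 1)

lemma F1_xb (m j : ℕ) : Fmap 1 (xb m j) = xb (m + 1) j := by
  simp [Fmap, xb, q, pow_succ]; field_simp

lemma F2_xb (m j : ℕ) : Fmap 2 (xb m j) = xb (m + 1) (2 ^ m + j) := by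
  simp [Fmap, xb, q, pow_succ]; field_simp; ring

lemma xb_zero (m : ℕ) : xb m 0 = q 1 := by simp [xb]
lemma xb_last (m : ℕ) : xb m (2 ^ m) = q 2 := by simp [xb]

lemma xb_inj (m i j : ℕ) : xb m i = xb m j ↔ i = j := by
  constructor
  · intro h
    have := congrArg Prod.fst h
    simp [xb, q] at this
    exact this
  · rintro rfl; rfl

lemma xb_T (m j : ℕ) (h : j ≤ 2 ^ m) : xb m j ∈ T := by
  have h' : (j : ℝ) / 2 ^ m ≤ 1 := by
    rw [div_le_one (by positivity)]; exact_mod_cast h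
  have h'' : 0 ≤ (j : ℝ) / 2 ^ m := by positivity
  intro i
  fin_cases i <;> simp [bc, xb, q] <;> linarith

lemma mu_succ (m : ℕ) (v : ℝ × ℝ → ℝ) :
    mu (m + 1) v = (mu m (v ∘ Fmap 1) + mu m (v ∘ Fmap 2)) / 2 := by
  simp only [mu, Function.comp, F1_xb, F2_xb]
  rw [show 2 ^ (m + 1) = 2 ^ m + 2 ^ m by ring, Finset.sum_range_add]
  simp only [add_assoc]
  field_simp
  ring

lemma mu_congr (m : ℕ) {u v : ℝ × ℝ → ℝ} (h : ∀ j ≤ 2 ^ m, u (xb m j) = v (xb m j)) :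
    mu m u = mu m v := by
  unfold mu
  congr 1
  refine Finset.sum_congr rfl fun k hk => ?_
  have := Finset.mem_range.1 hk
  rw [h k (by omega), h (k + 1) (by omega)]

/-- trace energy of the bottom row -/
def R : ℕ → (ℝ × ℝ → ℝ) → ℝ
  | 0, v => 3 / 2 * (v (q 1) - v (q 2)) ^ 2
  | m + 1, v => 5 / 3 * (3 * al m / (2 * al m + 6) * (mu m (v ∘ Fmap 1) - mu m (v ∘ Fmap 2)) ^ 2
      + R m (v ∘ Fmap 1) + R m (v ∘ Fmap 2))

lemma R_congr (m : ℕ) {u v : ℝ × ℝ → ℝ} (h : ∀ j ≤ 2 ^ m, u (xb m j) = v (xb m j)) :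
    R m u = R m v := by
  induction m generalizing u v with
  | zero =>
    have h0 := h 0 (by simp)
    have h1 := h (2 ^ 0) le_rfl
    rw [xb_zero] at h0
    rw [xb_last] at h1
    simp only [R, h0, h1]
  | succ m ih =>
    have a1 : ∀ j ≤ 2 ^ m, (u ∘ Fmap 1) (xb m j) = (v ∘ Fmap 1) (xb m j) := by
      intro j hj
      simp only [Function.comp, F1_xb]
      exact h _ (by rw [pow_succ]; omega)
    have a2 : ∀ j ≤ 2 ^ m, (u ∘ Fmap 2) (xb m j) = (v ∘ Fmap 2) (xb m j) := by
      intro j hj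
      simp only [Function.comp, F2_xb]
      exact h _ (by rw [pow_succ]; omega)
    simp only [R, ih a1, ih a2, mu_congr m a1, mu_congr m a2]

lemma mu_zero0 (v : ℝ × ℝ → ℝ) : mu 0 v = (v (q 1) + v (q 2)) / 2 := by
  have := xb_zero 0
  have h := xb_last 0
  simp only [pow_zero] at h
  simp [mu, this, h]

lemma R_zero (m : ℕ) : R m (fun _ => 0) = 0 := by
  induction m with
  | zero => simp [R]
  | succ m ih => simp [R, Function.comp_def, ih]

lemma quad (A t a b M N : ℝ) (hA : 0 < A) :
    E0 t a b + A * (a - M) ^ 2 + A * (b - N) ^ 2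
      = 2 * A / (1 + A) * (t - (M + N) / 2) ^ 2 + 3 * A / (2 * A + 6) * (M - N) ^ 2
        + 2 * (1 + A) * ((a + b) / 2 - (t + A * ((M + N) / 2)) / (1 + A)) ^ 2
        + 2 * (3 + A) * ((a - b) / 2 - A * ((M - N) / 2) / (3 + A)) ^ 2 := by
  have h1 : (1 + A) ≠ 0 := by positivity
  have h2 : (3 + A) ≠ 0 := by positivity
  rw [show 2 * A + 6 = 2 * (3 + A) by ring]
  simp only [E0]
  field_simp
  ring

lemma row_lower (m : ℕ) (u : ℝ × ℝ → ℝ) :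
    al m * (u (q 0) - mu m u) ^ 2 + R m u ≤ Energy m u := by
  induction m generalizing u with
  | zero =>
    rw [Energy_zero, mu_zero0]
    simp only [R, al, E0]
    apply le_of_eq; ring
  | succ m ih =>
    rw [Energy_succ, mu_succ]
    have h0 := corner_lower m (u ∘ Fmap 0)
    have h1 := ih (u ∘ Fmap 1)
    have h2 := ih (u ∘ Fmap 2)
    have hA := al_pos m
    have hq := quad (al m) (u (q 0)) (u (Fmap 0 (q 1))) (u (Fmap 0 (q 2)))
      (mu m (u ∘ Fmap 1)) (mu m (u ∘ Fmap 2)) hA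
    rw [Function.comp_apply, Function.comp_apply, Function.comp_apply, F_fix] at h0
    rw [Function.comp_apply, F_swap 1 0] at h1
    rw [Function.comp_apply, F_swap 2 0] at h2
    have e : al (m + 1) = 5 / 3 * (2 * al m / (1 + al m)) := by
      rw [al]; field_simp; ring
    rw [R, e]
    generalize mu m (u ∘ Fmap 1) = M at *
    generalize mu m (u ∘ Fmap 2) = N at *
    have p1 : 0 ≤ 2 * (1 + al m) * ((u (Fmap 0 (q 1)) + u (Fmap 0 (q 2))) / 2
      - (u (q 0) + al m * ((M + N) / 2)) / (1 + al m)) ^ 2 := by positivity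
    have p2 : 0 ≤ 2 * (3 + al m) * ((u (Fmap 0 (q 1)) - u (Fmap 0 (q 2))) / 2
      - al m * ((M - N) / 2) / (3 + al m)) ^ 2 := by positivity
    linarith

lemma row_exists (m : ℕ) (v : ℝ × ℝ → ℝ) (t : ℝ) :
    ∃ u : ℝ × ℝ → ℝ, (∀ j ≤ 2 ^ m, u (xb m j) = v (xb m j)) ∧ u (q 0) = t ∧
      Energy m u = al m * (t - mu m v) ^ 2 + R m v := by
  induction m generalizing v t with
  | zero =>
    obtain ⟨u, h0, h1, h2, h⟩ := corner_exists 0 t (v (q 1)) (v (q 2))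
    refine ⟨u, ?_, h0, ?_⟩
    · intro j hj
      have hx := xb_last 0
      simp only [pow_zero] at hx hj
      interval_cases j
      · rw [xb_zero, h1]
      · rw [hx, h2]
    · rw [h, mu_zero0]; simp only [R, al, E0]; ring
  | succ m ih =>
    have hA := al_pos m
    set M := mu m (v ∘ Fmap 1) with hM
    set N := mu m (v ∘ Fmap 2) with hN
    set s := (t + al m * ((M + N) / 2)) / (1 + al m) with hs
    set d := al m * ((M - N) / 2) / (3 + al m) with hd
    obtain ⟨f, hf0, hf1, hf2, hf⟩ := corner_exists m t (s + d) (s - d)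
    obtain ⟨g, hg, hg0, hge⟩ := ih (v ∘ Fmap 1) (s + d)
    obtain ⟨k, hk, hk0, hke⟩ := ih (v ∘ Fmap 2) (s - d)
    have hg2 := hg (2 ^ m) le_rfl
    have hk1 := hk 0 (by positivity)
    rw [xb_last] at hg2
    rw [xb_zero] at hk1
    obtain ⟨u, u0, u1, u2, hu⟩ := glue_energy m f g k (by rw [hf1, hg0]) (by rw [hf2, hk0])
      (by rw [hg2, hk1, Function.comp_apply, Function.comp_apply, F_swap])
    refine ⟨u, ?_, ?_, ?_⟩
    · intro j hj
      by_cases hjm : j ≤ 2 ^ m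
      · rw [← F1_xb, u1 _ (xb_T _ _ hjm), hg _ hjm]; rfl
      · obtain ⟨i, rfl⟩ : ∃ i, j = 2 ^ m + i := ⟨j - 2 ^ m, by omega⟩
        have hi : i ≤ 2 ^ m := by rw [pow_succ] at hj; omega
        rw [← F2_xb, u2 _ (xb_T _ _ hi), hk _ hi]; rfl
    · rw [← F_fix, u0 _ (q_mem_T _), hf0]
    · have hq := quad (al m) t (s + d) (s - d) M N hA
      rw [← hs, ← hd, show (s + d + (s - d)) / 2 - s = 0 by ring,
        show (s + d - (s - d)) / 2 - d = 0 by ring] at hq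
      have e : al (m + 1) = 5 / 3 * (2 * al m / (1 + al m)) := by
        rw [al]; field_simp; ring
      rw [hu, hf, hge, hke, mu_succ, R, e, ← hM, ← hN]
      linarith

lemma Q_eq (m : ℕ) (v : ℝ × ℝ → ℝ) : Q m (Ebot m) v = R m v := by
  apply IsLeast.csInf_eq
  constructor
  · obtain ⟨u, hu, -, he⟩ := row_exists m v (mu m v)
    refine ⟨u, ?_, ?_⟩
    · rintro _ ⟨j, hj, rfl⟩
      exact hu j hj
    · rw [he]; ring
  · rintro _ ⟨u, hu, rfl⟩
    have h : ∀ j ≤ 2 ^ m, u (xb m j) = v (xb m j) := fun j hj => hu _ ⟨j, hj, rfl⟩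
    have := row_lower m u
    rw [R_congr m h] at this
    have := al_pos m
    have : 0 ≤ al m * (u (q 0) - mu m u) ^ 2 := by positivity
    linarith

lemma cond_eq (m i j : ℕ) (hi : i < 2 ^ m) (hj : 0 < j) (hj' : j ≤ 2 ^ m) :
    cond (m + 1) (Ebot (m + 1)) (xb (m + 1) i) (xb (m + 1) (2 ^ m + j)) =
      5 * al m / (2 * al m + 6) * (mu m (ind (xb m i)) * mu m (ind (xb m j))) := by
  have x1 : ∀ k ≤ 2 ^ m, (ind (xb (m + 1) i) ∘ Fmap 1) (xb m k) = ind (xb m i) (xb m k) := by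
    intro k hk
    simp [ind, F1_xb, xb_inj]
  have x2 : ∀ k ≤ 2 ^ m, (ind (xb (m + 1) i) ∘ Fmap 2) (xb m k) = (fun _ => 0) (xb m k) := by
    intro k hk
    simp [ind, F2_xb, xb_inj]; omega
  have y1 : ∀ k ≤ 2 ^ m, (ind (xb (m + 1) (2 ^ m + j)) ∘ Fmap 1) (xb m k)
      = (fun _ => 0) (xb m k) := by
    intro k hk
    simp [ind, F1_xb, xb_inj]; omega
  have y2 : ∀ k ≤ 2 ^ m, (ind (xb (m + 1) (2 ^ m + j)) ∘ Fmap 2) (xb m k)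
      = ind (xb m j) (xb m k) := by
    intro k hk
    simp [ind, F2_xb, xb_inj]
  have z1 : ∀ k ≤ 2 ^ m, ((ind (xb (m + 1) i) + ind (xb (m + 1) (2 ^ m + j))) ∘ Fmap 1) (xb m k)
      = ind (xb m i) (xb m k) := by
    intro k hk
    have a := x1 k hk
    have b := y1 k hk
    simp only [Function.comp, Pi.add_apply] at a b ⊢
    rw [a, b, add_zero]
  have z2 : ∀ k ≤ 2 ^ m, ((ind (xb (m + 1) i) + ind (xb (m + 1) (2 ^ m + j))) ∘ Fmap 2) (xb m k)
      = ind (xb m j) (xb m k) := by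
    intro k hk
    have a := x2 k hk
    have b := y2 k hk
    simp only [Function.comp, Pi.add_apply] at a b ⊢
    rw [a, b, zero_add]
  have mz : mu m (fun _ => 0) = 0 := by simp [mu]
  simp only [cond, Q_eq, R]
  rw [R_congr m (u := ind (xb (m + 1) i) ∘ Fmap 1)
      (v := ind (xb m i)) x1,
    R_congr m (u := ind (xb (m + 1) i) ∘ Fmap 2)
      (v := fun _ => 0) x2,
    R_congr m (u := ind (xb (m + 1) (2 ^ m + j)) ∘ Fmap 1)
      (v := fun _ => 0) y1,
    R_congr m (u := ind (xb (m + 1) (2 ^ m + j)) ∘ Fmap 2)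
      (v := ind (xb m j)) y2,
    R_congr m (u := (ind (xb (m + 1) i) + ind (xb (m + 1) (2 ^ m + j))) ∘ Fmap 1)
      (v := ind (xb m i)) z1,
    R_congr m (u := (ind (xb (m + 1) i) + ind (xb (m + 1) (2 ^ m + j))) ∘ Fmap 2)
      (v := ind (xb m j)) z2,
    mu_congr m (u := ind (xb (m + 1) i) ∘ Fmap 1)
      (v := ind (xb m i)) x1,
    mu_congr m (u := ind (xb (m + 1) i) ∘ Fmap 2)
      (v := fun _ => 0) x2,
    mu_congr m (u := ind (xb (m + 1) (2 ^ m + j)) ∘ Fmap 1)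
      (v := fun _ => 0) y1,
    mu_congr m (u := ind (xb (m + 1) (2 ^ m + j)) ∘ Fmap 2)
      (v := ind (xb m j)) y2,
    mu_congr m (u := (ind (xb (m + 1) i) + ind (xb (m + 1) (2 ^ m + j))) ∘ Fmap 1)
      (v := ind (xb m i)) z1,
    mu_congr m (u := (ind (xb (m + 1) i) + ind (xb (m + 1) (2 ^ m + j))) ∘ Fmap 2)
      (v := ind (xb m j)) z2,
    R_zero, mz]
  ring

lemma mu_ind (m j : ℕ) : mu m (ind (xb m j)) =
    ((if j < 2 ^ m then 1 else 0) + (if 0 < j ∧ j ≤ 2 ^ m then 1 else 0)) / 2 ^ (m + 1) := by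
  unfold mu
  congr 1
  simp only [ind, xb_inj, Finset.sum_add_distrib]
  congr 1
  · simp
  · cases j with
    | zero => simp
    | succ j => simp [Nat.succ_le_iff]

/-- Conductances of the bottom row `Ẽ_n` at level `n` between the two
halves, with `b̃_n = c̃^n_{x₀,x_{2ⁿ}} = 35·5ⁿ/(10·6ⁿ + 32·20ⁿ)`. -/
theorem stmt16 (n : ℕ) (hn : 1 ≤ n) :
    (∀ j : ℕ, 2 ^ (n - 1) < j → j < 2 ^ n →
      cond n (Ebot n) (xb n 0) (xb n j) =
        2 * cond n (Ebot n) (xb n 0) (xb n (2 ^ n))) ∧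
    (∀ j : ℕ, 0 < j → j < 2 ^ (n - 1) →
      cond n (Ebot n) (xb n j) (xb n (2 ^ n)) =
        2 * cond n (Ebot n) (xb n 0) (xb n (2 ^ n))) ∧
    (∀ i j : ℕ, 0 < i → i < 2 ^ (n - 1) → 2 ^ (n - 1) < j → j < 2 ^ n →
      cond n (Ebot n) (xb n i) (xb n j) =
        4 * cond n (Ebot n) (xb n 0) (xb n (2 ^ n))) ∧
    cond n (Ebot n) (xb n 0) (xb n (2 ^ n)) =
      35 * 5 ^ n / (10 * 6 ^ n + 32 * 20 ^ n) := by
  obtain ⟨m, rfl⟩ : ∃ m, n = m + 1 := ⟨n - 1, by omega⟩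
  have hpos : 0 < 2 ^ m := by positivity
  have e2 : 2 ^ (m + 1) = 2 ^ m + 2 ^ m := by ring
  have m0 : mu m (ind (xb m 0)) = 1 / 2 ^ (m + 1) := by rw [mu_ind]; simp
  have m1 : mu m (ind (xb m (2 ^ m))) = 1 / 2 ^ (m + 1) := by rw [mu_ind]; simp
  have mi : ∀ j, 0 < j → j < 2 ^ m → mu m (ind (xb m j)) = 2 / 2 ^ (m + 1) := by
    intro j h h'
    rw [mu_ind, if_pos h', if_pos ⟨h, h'.le⟩]; norm_num
  have hb : cond (m + 1) (Ebot (m + 1)) (xb (m + 1) 0) (xb (m + 1) (2 ^ (m + 1)))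
      = 5 * al m / (2 * al m + 6) * (1 / 2 ^ (m + 1) * (1 / 2 ^ (m + 1))) := by
    rw [congrArg (xb (m + 1)) e2, cond_eq m 0 _ hpos hpos le_rfl, m0, m1]
  rw [hb, Nat.add_sub_cancel]
  refine ⟨?_, ?_, ?_, ?_⟩
  · intro j h h'
    obtain ⟨i, rfl⟩ : ∃ i, j = 2 ^ m + i := ⟨j - 2 ^ m, by omega⟩
    rw [cond_eq m 0 i hpos (by omega) (by omega), m0, mi i (by omega) (by omega)]
    ring
  · intro j h h'
    rw [congrArg (xb (m + 1)) e2, cond_eq m j _ h' hpos le_rfl, m1, mi j h h']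
    ring
  · intro k j h1 h2 h h'
    obtain ⟨i, rfl⟩ : ∃ i, j = 2 ^ m + i := ⟨j - 2 ^ m, by omega⟩
    rw [cond_eq m k i h2 (by omega) (by omega), mi k h1 h2, mi i (by omega) (by omega)]
    ring
  · have hA := al_pos m
    have hr := al_inv m
    have h1 : 5 * al m / (2 * al m + 6) = 5 / (2 + 6 * (al m)⁻¹) := by field_simp
    rw [h1, hr, show (6:ℝ) ^ (m + 1) = 2 ^ (m + 1) * 3 ^ (m + 1) by rw [← mul_pow]; norm_num,
      show (20:ℝ) ^ (m + 1) = 2 ^ (m + 1) * 2 ^ (m + 1) * 5 ^ (m + 1) by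
        rw [← mul_pow, ← mul_pow]; norm_num,
      show (3 / 10 : ℝ) ^ m = 3 ^ m / (2 ^ m * 5 ^ m) by
        rw [div_pow, ← mul_pow]; norm_num]
    have a2 : (0:ℝ) < 2 ^ m := by positivity
    have a3 : (0:ℝ) < 3 ^ m := by positivity
    have a5 : (0:ℝ) < 5 ^ m := by positivity
    simp only [pow_succ]
    generalize (2:ℝ) ^ m = x at *
    generalize (3:ℝ) ^ m = y at *
    generalize (5:ℝ) ^ m = z at *
    rw [← sub_eq_zero]
    field_simp
    ring

end SGPaper
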